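/- arXiv:2006.09647 — 2 statements merged into one kernel-verified Lean document; each statement's English description precedes it below -/
import Mathlib

section
/- Let θ* ∈ ℝ, let i > 0 (the Fisher information scalar), let m ≥ 1 be a natural number, and let ε ∈ (0,1). Let q > 0 satisfy gammaMeasure (1/2) (1/2) (Set.Iic q) = ENNReal.ofReal (1 − ε), i.e., q is the (1−ε)-quantile of the chi-squared distribution with one degree of freedom. Let T and T' be independent real-valued random variables on a probability space (Ω, P), each with law gaussianReal θ* (1/(m·i)). Then P { ω | i · (T ω − T' ω)^2 ≥ (2/m) · q } = ENNReal.ofReal ε. -/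
open MeasureTheory ProbabilityTheory

open scoped ENNReal NNReal

lemma lintegral_eq_two_mul_setLIntegral_Ioi_of_even {f : ℝ → ℝ≥0∞} (hf : ∀ x, f (-x) = f x) :
    ∫⁻ x, f x = 2 * ∫⁻ x in Set.Ioi 0, f x := by
  have hneg : ∫⁻ x in Set.Iic 0, f x = ∫⁻ x in Set.Ioi 0, f x := by
    rw [← setLIntegral_congr (Iio_ae_eq_Iic (μ := volume) (a := (0 : ℝ)))]
    have h := (Measure.measurePreserving_neg (volume : Measure ℝ)).setLIntegral_comp_preimage_emb
      (MeasurableEquiv.neg ℝ).measurableEmbedding f (Set.Ioi 0)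
    simpa [hf] using h
  rw [← lintegral_add_compl f (measurableSet_Ioi (a := (0 : ℝ))), Set.compl_Ioi, hneg, two_mul]

lemma two_mul_mul_gammaPDF_sq {x : ℝ} (hx : 0 < x) :
    ENNReal.ofReal |2 * x| * gammaPDF (1 / 2) (1 / 2) (x ^ 2) = 2 * gaussianPDF 0 1 x := by
  have h2 : (2 : ℝ≥0∞) = ENNReal.ofReal 2 := by simp
  rw [gammaPDF_of_nonneg (sq_nonneg x), gaussianPDF, h2, ← ENNReal.ofReal_mul (abs_nonneg _),
    ← ENNReal.ofReal_mul zero_le_two, gaussianPDFReal, abs_of_pos (by positivity)]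
  congr 1
  have hpow : (x ^ 2) ^ ((1 : ℝ) / 2 - 1) = x⁻¹ := by
    rw [← Real.rpow_natCast, ← Real.rpow_mul hx.le, ← Real.rpow_neg_one]
    norm_num
  have hexp : -(1 / 2 * x ^ 2) = -(x - 0) ^ 2 / (2 * ((1 : ℝ≥0) : ℝ)) := by
    push_cast
    ring
  rw [hpow, Real.Gamma_one_half_eq, ← Real.sqrt_eq_rpow, hexp, Real.sqrt_div zero_le_one,
    Real.sqrt_one, NNReal.coe_one, mul_one, mul_one, Real.sqrt_mul zero_le_two]
  field_simp

/-- The square of a standard Gaussian has the chi-squared law with one degree of freedom. -/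
theorem gaussianReal_map_sq :
    (gaussianReal 0 1).map (fun x ↦ x ^ 2) = gammaMeasure (1 / 2) (1 / 2) := by
  ext s hs
  have hsq : Measurable fun x : ℝ ↦ x ^ 2 := by fun_prop
  have himage : (fun x : ℝ ↦ x ^ 2) '' Set.Ioi 0 = Set.Ioi 0 := by
    ext y
    refine ⟨?_, fun hy ↦ ⟨√y, Real.sqrt_pos.2 hy, Real.sq_sqrt (le_of_lt hy)⟩⟩
    rintro ⟨x, hx, rfl⟩
    exact pow_pos (Set.mem_Ioi.1 hx) 2
  have hinj : Set.InjOn (fun x : ℝ ↦ x ^ 2) (Set.Ioi 0) := fun x hx y hy h ↦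
    (pow_left_inj₀ (le_of_lt hx) (le_of_lt hy) two_ne_zero).1 h
  have hgamma : ∫⁻ y, s.indicator (gammaPDF (1 / 2) (1 / 2)) y
      = ∫⁻ x in Set.Ioi 0, ENNReal.ofReal |2 * x| *
          s.indicator (gammaPDF (1 / 2) (1 / 2)) (x ^ 2) := by
    have hsupp : Function.support (s.indicator (gammaPDF (1 / 2) (1 / 2))) ⊆ Set.Ici 0 := by
      intro y hy
      by_contra hneg
      simp [gammaPDF_of_neg (not_le.1 hneg)] at hy
    rw [← setLIntegral_eq_of_support_subset hsupp, ← setLIntegral_congr Ioi_ae_eq_Ici]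
    nth_rw 1 [← himage]
    exact lintegral_image_eq_lintegral_abs_deriv_mul measurableSet_Ioi
      (fun x _ ↦ by simpa using (hasDerivAt_pow 2 x).hasDerivWithinAt) hinj _
  rw [Measure.map_apply hsq hs, gaussianReal_apply _ one_ne_zero, gammaMeasure,
    withDensity_apply _ hs, ← lintegral_indicator hs, ← lintegral_indicator (hsq hs), hgamma,
    lintegral_eq_two_mul_setLIntegral_Ioi_of_even, ← lintegral_const_mul' _ _ ENNReal.ofNat_ne_top]
  · refine setLIntegral_congr_fun measurableSet_Ioi fun x hx ↦ ?_
    by_cases hxs : x ^ 2 ∈ s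
    · simpa only [Set.indicator, Set.mem_preimage, hxs, if_true] using
        (two_mul_mul_gammaPDF_sq hx).symm
    · simp [Set.indicator, hxs]
  · intro x
    by_cases hxs : x ^ 2 ∈ s <;> simp [Set.indicator, hxs, gaussianPDF, gaussianPDFReal]

/-- The rescaled squared difference of two i.i.d. Gaussians is chi-squared distributed. -/
lemma map_sq_sub_of_indepFun {Ω : Type*} [MeasurableSpace Ω] {P : Measure Ω}
    {X Y : Ω → ℝ} {μ : ℝ} {v : ℝ≥0} (hv : v ≠ 0) (hX : Measurable X) (hY : Measurable Y)
    (hindep : IndepFun X Y P) (hlawX : P.map X = gaussianReal μ v)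
    (hlawY : P.map Y = gaussianReal μ v) :
    P.map (fun ω ↦ (X ω - Y ω) ^ 2 / (2 * v)) = gammaMeasure (1 / 2) (1 / 2) := by
  have hneg : P.map (-Y) = gaussianReal (-μ) v :=
    (gaussianReal_neg (X := Y) ⟨hY.aemeasurable, hlawY⟩).map_eq
  have hsub : P.map (X + -Y) = gaussianReal (μ + -μ) (v + v) :=
    gaussianReal_add_gaussianReal_of_indepFun (hindep.comp measurable_id measurable_neg)
      hlawX hneg
  have hstd : P.map (fun ω ↦ (X + -Y) ω / √(2 * v)) = gaussianReal 0 1 := by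
    rw [(gaussianReal_div_const ⟨(hX.add hY.neg).aemeasurable, hsub⟩ √(2 * v)).map_eq]
    congr 1
    · simp
    · ext
      have : (v : ℝ) ≠ 0 := by exact_mod_cast hv
      push_cast
      rw [Real.sq_sqrt (by positivity)]
      field_simp
      norm_num
  rw [← gaussianReal_map_sq, ← hstd, Measure.map_map (by fun_prop) (by fun_prop)]
  congr 1
  ext ω
  simp [div_pow, sub_eq_add_neg, mul_pow]

/-- Exact finite-sample Gaussian null distribution of the audit statistic (r = 1):
if the two independent estimates are Gaussian with common mean `θ*` and variance
`1/(m·i)`, the audit statistic exceeds the chi-squared threshold with probability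
exactly `ε`. -/
theorem audit_false_positive_rate_exact
    (θstar : ℝ) (i : ℝ) (hi : 0 < i)
    (m : ℕ) (hm : 1 ≤ m)
    (ε : ℝ) (hε : ε ∈ Set.Ioo (0 : ℝ) 1)
    (q : ℝ) (hq : 0 < q)
    (hquant : gammaMeasure (1 / 2) (1 / 2) (Set.Iic q) = ENNReal.ofReal (1 - ε))
    {Ω : Type*} [MeasurableSpace Ω] (P : Measure Ω) [IsProbabilityMeasure P]
    (T T' : Ω → ℝ) (hT : Measurable T) (hT' : Measurable T')
    (hindep : IndepFun T T' P)
    (hlawT : P.map T = gaussianReal θstar (Real.toNNReal (1 / (m * i))))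
    (hlawT' : P.map T' = gaussianReal θstar (Real.toNNReal (1 / (m * i)))) :
    P {ω | i * (T ω - T' ω) ^ 2 ≥ (2 / m) * q} = ENNReal.ofReal ε := by
  have hm0 : (0 : ℝ) < m := by exact_mod_cast hm
  have hvar : 0 < 1 / (m * i) := by positivity
  have hlaw := map_sq_sub_of_indepFun (Real.toNNReal_pos.2 hvar).ne' hT hT' hindep hlawT hlawT'
  have hset : {ω | i * (T ω - T' ω) ^ 2 ≥ (2 / m) * q}
      = (fun ω ↦ (T ω - T' ω) ^ 2 / (2 * (Real.toNNReal (1 / (m * i)) : ℝ))) ⁻¹' Set.Ici q := by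
    ext ω
    rw [Real.coe_toNNReal _ hvar.le]
    simp only [ge_iff_le, Set.mem_ofPred_eq, Set.mem_preimage, Set.mem_Ici]
    rw [le_div_iff₀ (by positivity)]
    field_simp
  have : IsProbabilityMeasure (gammaMeasure (1 / 2) (1 / 2)) :=
    isProbabilityMeasure_gammaMeasure one_half_pos one_half_pos
  have : NullSingletonClass (gammaMeasure (1 / 2) (1 / 2)) := by
    unfold gammaMeasure
    infer_instance
  rw [hset, ← Measure.map_apply (by fun_prop) measurableSet_Ici, hlaw,
    ← measure_congr Ioi_ae_eq_Ici, ← Set.compl_Iic, prob_compl_eq_one_sub measurableSet_Iic,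
    hquant, ← ENNReal.ofReal_one, ← ENNReal.ofReal_sub _ (sub_nonneg.2 hε.2.le), sub_sub_cancel]
end

section
/- Let r ≥ 1, let θ* ∈ ℝ^r, let A be an invertible r × r real matrix, and let ε ∈ (0,1). Let q > 0 satisfy gammaMeasure (r/2) (1/2) (Set.Iic q) = ENNReal.ofReal (1 − ε). Let γ denote the pushforward of the r-fold product measure ⊗_{j : Fin r} gaussianReal 0 1 under the linear map g ↦ A.mulVec g (so γ is the centered multivariate Gaussian with covariance Σ = A·Aᵀ). For each m ≥ 1, let T_m and T'_m be measurable maps from a probability space (Ω, P) to ℝ^r such that T_m and T'_m are independent, and suppose the law of ω ↦ √m • (T_m ω − θ*) and the law of ω ↦ √m • (T'_m ω − θ*) both converge weakly (in the topology of weak convergence of probability measures on ℝ^r) to γ as m → ∞. Then P { ω | (T_m ω − T'_m ω) ⬝ ((A * Aᵀ)⁻¹).mulVec (T_m ω − T'_m ω) ≥ (2/m) · q } tends to ENNReal.ofReal ε as m → ∞. -/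
open MeasureTheory ProbabilityTheory Filter Topology Matrix

theorem measurable_gammaPDF (a b : ℝ) : Measurable (gammaPDF a b) :=
  (measurable_gammaPDFReal a b).ennreal_ofReal

theorem mgf_id_gammaMeasure {a b : ℝ} (ha : 0 < a) (hb : 0 < b) {t : ℝ} (ht : t < b) :
    mgf id (gammaMeasure a b) t = (b / (b - t)) ^ a := by
  have hbt : 0 < b - t := sub_pos.2 ht
  rw [mgf, gammaMeasure, integral_withDensity_eq_integral_toReal_smul
    (measurable_gammaPDF a b) (ae_of_all _ fun _ ↦ ENNReal.ofReal_lt_top)]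
  have h : (fun x : ℝ ↦ (gammaPDF a b x).toReal • Real.exp (t * id x)) =ᵐ[volume]
      (Set.Ioi 0).indicator fun x ↦
        b ^ a / Real.Gamma a * (x ^ (a - 1) * Real.exp (-((b - t) * x))) := by
    filter_upwards [Measure.ae_ne volume (0 : ℝ)] with x hx
    rw [gammaPDF, ENNReal.toReal_ofReal (gammaPDFReal_nonneg ha hb x), gammaPDFReal]
    rcases lt_or_gt_of_ne hx with h | h
    · simp [h.not_ge, h.le]
    · rw [if_pos h.le, Set.indicator_of_mem (Set.mem_Ioi.2 h), smul_eq_mul, id, mul_assoc,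
        mul_assoc, ← Real.exp_add]
      ring_nf
  rw [integral_congr_ae h, integral_indicator measurableSet_Ioi, integral_const_mul,
    Real.integral_rpow_mul_exp_neg_mul_Ioi ha hbt, Real.div_rpow hb.le hbt.le,
    Real.div_rpow one_pos.le hbt.le, Real.one_rpow]
  have := (Real.Gamma_pos_of_pos ha).ne'
  field_simp

theorem mgf_id_gammaMeasure_of_le {a b : ℝ} (ha : 0 < a) (hb : 0 < b) {t : ℝ} (ht : b ≤ t) :
    mgf id (gammaMeasure a b) t = 0 := by
  refine mgf_undef fun hint ↦ not_integrableOn_Ioi_rpow (a - 1) ?_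
  rw [gammaMeasure, integrable_withDensity_iff_integrable_smul'
    (measurable_gammaPDF a b) (ae_of_all _ fun _ ↦ ENNReal.ofReal_lt_top)] at hint
  have hG := Real.Gamma_pos_of_pos ha
  have hc : 0 < b ^ a / Real.Gamma a := by positivity
  refine (hint.integrableOn (s := Set.Ioi 0)).const_mul (b ^ a / Real.Gamma a)⁻¹ |>.mono'
    (by fun_prop) ?_
  filter_upwards [ae_restrict_mem measurableSet_Ioi] with x hx
  have hx : 0 < x := hx
  rw [gammaPDF, ENNReal.toReal_ofReal (gammaPDFReal_nonneg ha hb x), gammaPDFReal, if_pos hx.le,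
    smul_eq_mul, id, Real.norm_of_nonneg (by positivity), mul_assoc, mul_assoc, ← Real.exp_add,
    inv_mul_cancel_left₀ hc.ne']
  refine le_mul_of_one_le_right (by positivity) (Real.one_le_exp ?_)
  nlinarith

theorem integral_exp_mul_sq_gaussianReal (t : ℝ) :
    ∫ x, Real.exp (t * x ^ 2) ∂gaussianReal 0 1 = √((1 / 2) / (1 / 2 - t)) := by
  rw [integral_gaussianReal_eq_integral_smul one_ne_zero]
  have h (x : ℝ) : gaussianPDFReal 0 1 x • Real.exp (t * x ^ 2) =
      (√(2 * Real.pi))⁻¹ * Real.exp (-(1 / 2 - t) * x ^ 2) := by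
    rw [gaussianPDFReal, smul_eq_mul, mul_assoc, ← Real.exp_add]
    simp only [NNReal.coe_one, mul_one, sub_zero]
    ring_nf
  simp_rw [h]
  rw [integral_const_mul, integral_gaussian, ← Real.sqrt_inv, ← Real.sqrt_mul (by positivity)]
  congr 1
  have := Real.pi_ne_zero
  rw [div_eq_mul_inv _ (1 / 2 - t), div_eq_mul_inv _ (1 / 2 - t)]
  field_simp

theorem mgf_sum_sq_pi_gaussianReal {ι : Type*} [Fintype ι] (t : ℝ) :
    mgf (fun x : ι → ℝ ↦ ∑ i, x i ^ 2) (Measure.pi fun _ ↦ gaussianReal 0 1) t =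
      √((1 / 2) / (1 / 2 - t)) ^ Fintype.card ι := by
  simp_rw [mgf, Finset.mul_sum, Real.exp_sum]
  rw [integral_fintype_prod_eq_pow (fun x : ℝ ↦ Real.exp (t * x ^ 2)),
    integral_exp_mul_sq_gaussianReal]

theorem ext_of_mgf_id_eq {μ ν : Measure ℝ} [IsProbabilityMeasure μ] [IsProbabilityMeasure ν]
    (h : mgf id μ = mgf id ν) (h0 : 0 ∈ interior (integrableExpSet id μ)) : μ = ν := by
  refine Measure.ext_of_charFun (funext fun t ↦ ?_)
  rw [← complexMGF_id_mul_I, ← complexMGF_id_mul_I]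
  exact eqOn_complexMGF_of_mgf h (by simpa using h0)

/-- The squared norm of a standard Gaussian vector follows a chi-squared distribution. -/
theorem map_sum_sq_pi_gaussianReal {ι : Type*} [Fintype ι] [Nonempty ι] :
    (Measure.pi fun _ : ι ↦ gaussianReal 0 1).map (fun x ↦ ∑ i, x i ^ 2) =
      gammaMeasure (Fintype.card ι / 2) (1 / 2) := by
  have hr : 0 < Fintype.card ι := Fintype.card_pos
  have ha : (0 : ℝ) < Fintype.card ι / 2 := by positivity
  have hb : (0 : ℝ) < 1 / 2 := by norm_num
  have hX : Measurable fun x : ι → ℝ ↦ ∑ i, x i ^ 2 := by fun_prop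
  have := isProbabilityMeasure_gammaMeasure ha hb
  have := Measure.isProbabilityMeasure_map
    (μ := Measure.pi fun _ : ι ↦ gaussianReal 0 1) hX.aemeasurable
  symm
  refine ext_of_mgf_id_eq (funext fun t ↦ ?_) ?_
  · rw [mgf_id_map hX.aemeasurable, mgf_sum_sq_pi_gaussianReal]
    rcases lt_or_ge t (1 / 2) with ht | ht
    · have : 0 < 1 / 2 - t := sub_pos.2 ht
      rw [mgf_id_gammaMeasure ha hb ht, Real.sqrt_eq_rpow, ← Real.rpow_natCast,
        ← Real.rpow_mul (by positivity)]
      ring_nf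
    · rw [mgf_id_gammaMeasure_of_le ha hb ht, Real.sqrt_eq_zero_of_nonpos, zero_pow hr.ne']
      exact div_nonpos_of_nonneg_of_nonpos hb.le (sub_nonpos.2 ht)
  · refine mem_interior.2 ⟨Set.Iio (1 / 2), fun t ht ↦ ?_, isOpen_Iio, hb⟩
    have : 0 < 1 / 2 - t := sub_pos.2 ht
    refine (mgf_pos_iff (hμ := inferInstance)).1 ?_
    rw [mgf_id_gammaMeasure ha hb ht]
    positivity

theorem map_sub_div_sqrt_two_gaussianReal :
    ((gaussianReal 0 1).prod (gaussianReal 0 1)).map (fun p : ℝ × ℝ ↦ (p.1 - p.2) / √2) =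
      gaussianReal 0 1 := by
  have hind : IndepFun (fun p : ℝ × ℝ ↦ p.1) (fun p : ℝ × ℝ ↦ -p.2)
      ((gaussianReal 0 1).prod (gaussianReal 0 1)) :=
    indepFun_prod (X := fun x : ℝ ↦ x) (Y := fun x : ℝ ↦ -x) measurable_id measurable_neg
  have h1 : ((gaussianReal 0 1).prod (gaussianReal 0 1)).map (fun p : ℝ × ℝ ↦ p.1) =
      gaussianReal 0 1 := by
    simp
  have h2 : ((gaussianReal 0 1).prod (gaussianReal 0 1)).map (fun p : ℝ × ℝ ↦ -p.2) =
      gaussianReal 0 1 := by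
    have h := Measure.map_snd_prod (μ := gaussianReal 0 1) (ν := gaussianReal 0 1)
    rw [measure_univ, one_smul] at h
    change Measure.map ((fun x : ℝ ↦ -x) ∘ Prod.snd) _ = _
    rw [← Measure.map_map measurable_neg measurable_snd, h, gaussianReal_map_neg, neg_zero]
  have hsum := gaussianReal_add_gaussianReal_of_indepFun hind h1 h2
  have hcomp : (fun p : ℝ × ℝ ↦ (p.1 - p.2) / √2) =
      (· / √2) ∘ ((fun p : ℝ × ℝ ↦ p.1) + fun p : ℝ × ℝ ↦ -p.2) := by
    ext p; simp [sub_eq_add_neg]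
  rw [hcomp, ← Measure.map_map (by fun_prop) (by fun_prop), hsum, gaussianReal_map_div_const]
  congr 1
  · simp
  · ext; simp

/-- Half the squared distance between two independent standard Gaussian vectors follows a
chi-squared distribution. -/
theorem map_sum_sq_sub_div_two_pi_gaussianReal {ι : Type*} [Fintype ι] [Nonempty ι] :
    ((Measure.pi fun _ : ι ↦ gaussianReal 0 1).prod (Measure.pi fun _ : ι ↦ gaussianReal 0 1)).map
      (fun p ↦ (∑ i, (p.1 i - p.2 i) ^ 2) / 2) = gammaMeasure (Fintype.card ι / 2) (1 / 2) := by
  have := Measure.isProbabilityMeasure_map (μ := (gaussianReal 0 1).prod (gaussianReal 0 1))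
    (f := fun p : ℝ × ℝ ↦ (p.1 - p.2) / √2) (by fun_prop)
  rw [← (measurePreserving_arrowProdEquivProdArrow ℝ ℝ ι (fun _ ↦ gaussianReal 0 1)
    (fun _ ↦ gaussianReal 0 1)).map_eq, Measure.map_map (by fun_prop) (by fun_prop)]
  have hcomp : (fun p : (ι → ℝ) × (ι → ℝ) ↦ (∑ i, (p.1 i - p.2 i) ^ 2) / 2) ∘
      MeasurableEquiv.arrowProdEquivProdArrow ℝ ℝ ι =
      (fun x : ι → ℝ ↦ ∑ i, x i ^ 2) ∘ fun (p : ι → ℝ × ℝ) i ↦ ((p i).1 - (p i).2) / √2 := by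
    ext p
    simp [div_pow, Finset.sum_div, MeasurableEquiv.arrowProdEquivProdArrow,
      Equiv.arrowProdEquivProdArrow]
  rw [hcomp, ← Measure.map_map (by fun_prop) (by fun_prop),
    Measure.pi_map_pi (f := fun _ (p : ℝ × ℝ) ↦ (p.1 - p.2) / √2) (fun _ ↦ by fun_prop)]
  simp_rw [map_sub_div_sqrt_two_gaussianReal]
  exact map_sum_sq_pi_gaussianReal

theorem mulVec_dotProduct_inv_mul_transpose {n : Type*} [Fintype n] [DecidableEq n]
    {A : Matrix n n ℝ} (hA : IsUnit A.det) (v : n → ℝ) :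
    A *ᵥ v ⬝ᵥ (A * Aᵀ)⁻¹ *ᵥ (A *ᵥ v) = ∑ i, v i ^ 2 := by
  have hAt : IsUnit Aᵀ.det := by rwa [det_transpose]
  have hinv : (A * Aᵀ)⁻¹ *ᵥ (A *ᵥ v) = Aᵀ⁻¹ *ᵥ v := by
    rw [mulVec_mulVec, Matrix.mul_inv_rev, Matrix.mul_assoc, nonsing_inv_mul _ hA, Matrix.mul_one]
  rw [hinv, ← vecMul_transpose, ← dotProduct_mulVec, mulVec_mulVec, mul_nonsing_inv _ hAt,
    one_mulVec]
  simp [dotProduct, sq]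

/-- Theorem 1 of the paper in general dimension `r`: under the null hypothesis that both
counterfactual parameters equal `θ*`, if the two independent estimator sequences are
asymptotically normal with covariance `A·Aᵀ` (the inverse Fisher information), then the
false positive rate of the audit test converges to `ε`. -/
theorem audit_false_positive_rate_asymptotic_multivariate
    (r : ℕ) (hr : 1 ≤ r)
    (θstar : Fin r → ℝ)
    (A : Matrix (Fin r) (Fin r) ℝ) (hA : IsUnit A.det)
    (ε : ℝ) (hε : ε ∈ Set.Ioo (0 : ℝ) 1)
    (q : ℝ) (hq : 0 < q)
    (hquant : gammaMeasure (r / 2 : ℝ) (1 / 2) (Set.Iic q) = ENNReal.ofReal (1 - ε))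
    (γ : ProbabilityMeasure (Fin r → ℝ))
    (hγ : (γ : Measure (Fin r → ℝ)) =
      Measure.map (fun g => A.mulVec g) (Measure.pi (fun _ : Fin r => gaussianReal 0 1)))
    {Ω : Type*} [MeasurableSpace Ω] (P : Measure Ω) [IsProbabilityMeasure P]
    (T T' : ℕ → Ω → Fin r → ℝ)
    (hT : ∀ m, Measurable (T m)) (hT' : ∀ m, Measurable (T' m))
    (hindep : ∀ m, IndepFun (T m) (T' m) P)
    (μs μs' : ℕ → ProbabilityMeasure (Fin r → ℝ))
    (hμs : ∀ m, (μs m : Measure (Fin r → ℝ)) =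
      P.map (fun ω => Real.sqrt m • (T m ω - θstar)))
    (hμs' : ∀ m, (μs' m : Measure (Fin r → ℝ)) =
      P.map (fun ω => Real.sqrt m • (T' m ω - θstar)))
    (hlim : Tendsto μs atTop (𝓝 γ)) (hlim' : Tendsto μs' atTop (𝓝 γ)) :
    Tendsto (fun m : ℕ =>
        P {ω | (T m ω - T' m ω) ⬝ᵥ ((A * Aᵀ)⁻¹).mulVec (T m ω - T' m ω) ≥ (2 / m) * q})
      atTop (𝓝 (ENNReal.ofReal ε)) := by
  have : Nonempty (Fin r) := ⟨⟨0, hr⟩⟩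
  set F : (Fin r → ℝ) × (Fin r → ℝ) → ℝ :=
    fun p ↦ ((p.1 - p.2) ⬝ᵥ (A * Aᵀ)⁻¹ *ᵥ (p.1 - p.2)) / 2 with hF
  have hFc : Continuous F := by fun_prop
  have hFm := hFc.measurable
  have hAm : Measurable fun g : Fin r → ℝ ↦ A *ᵥ g :=
    (Continuous.matrix_mulVec continuous_const continuous_id).measurable
  have hlaw : ((γ : Measure (Fin r → ℝ)).prod (γ : Measure (Fin r → ℝ))).map F =
      gammaMeasure (r / 2 : ℝ) (1 / 2) := by
    rw [hγ, Measure.map_prod_map _ _ hAm hAm, Measure.map_map hFm (by fun_prop)]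
    have h := map_sum_sq_sub_div_two_pi_gaussianReal (ι := Fin r)
    rw [Fintype.card_fin] at h
    rw [← h]
    congr 1
    ext p
    simp only [hF, Function.comp_apply, Prod.map_fst, Prod.map_snd, ← Matrix.mulVec_sub,
      mulVec_dotProduct_inv_mul_transpose hA, Pi.sub_apply]
  have hprob : IsProbabilityMeasure (gammaMeasure (r / 2 : ℝ) (1 / 2)) :=
    isProbabilityMeasure_gammaMeasure (by positivity) (by norm_num)
  have hatom : gammaMeasure (r / 2 : ℝ) (1 / 2) {q} = 0 :=
    withDensity_absolutelyContinuous _ _ (measure_singleton q)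
  have hlimit := ProbabilityMeasure.tendsto_measure_of_null_frontier_of_tendsto'
    (ProbabilityMeasure.tendsto_map_of_tendsto_of_continuous _ _
      ((ProbabilityMeasure.continuous_prod.tendsto (γ, γ)).comp (hlim.prodMk_nhds hlim')) hFc)
    (E := Set.Ici q) (by
      rw [frontier_Ici, ProbabilityMeasure.toMeasure_map, ProbabilityMeasure.toMeasure_prod, hlaw,
        hatom])
  have htail : gammaMeasure (r / 2 : ℝ) (1 / 2) (Set.Ici q) = ENNReal.ofReal ε := by
    have hae : (Set.Ici q : Set ℝ) =ᵐ[gammaMeasure (r / 2 : ℝ) (1 / 2)] Set.Ioi q :=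
      (Ioi_ae_eq_Ici' hatom).symm
    rw [measure_congr hae, ← Set.compl_Iic, prob_compl_eq_one_sub measurableSet_Iic, hquant,
      ← ENNReal.ofReal_one, ← ENNReal.ofReal_sub _ (by linarith [hε.2])]
    congr 1
    ring
  simp only [ProbabilityMeasure.toMeasure_map, Function.comp_apply,
    ProbabilityMeasure.toMeasure_prod, hlaw, htail] at hlimit
  refine hlimit.congr' ?_
  filter_upwards [eventually_gt_atTop 0] with m hm
  have hm : (0 : ℝ) < m := Nat.cast_pos.2 hm
  have hX : Measurable fun ω ↦ √(m : ℝ) • (T m ω - θstar) := ((hT m).sub_const θstar).const_smul (√(m : ℝ))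
  have hX' : Measurable fun ω ↦ √(m : ℝ) • (T' m ω - θstar) :=
    ((hT' m).sub_const θstar).const_smul (√(m : ℝ))
  have hind : IndepFun (fun ω ↦ √(m : ℝ) • (T m ω - θstar))
      (fun ω ↦ √(m : ℝ) • (T' m ω - θstar)) P :=
    (hindep m).comp (φ := fun x ↦ √(m : ℝ) • (x - θstar)) (ψ := fun x ↦ √(m : ℝ) • (x - θstar))
      (by fun_prop) (by fun_prop)
  rw [hμs, hμs', ← (indepFun_iff_map_prod_eq_prod_map_map hX.aemeasurable hX'.aemeasurable).1 hind,
    Measure.map_map hFm (hX.prodMk hX'),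
    Measure.map_apply (hFm.comp (hX.prodMk hX')) measurableSet_Ici]
  congr 1
  ext ω
  simp only [hF, Set.mem_preimage, Function.comp_apply, Set.mem_Ici, Set.mem_ofPred_eq, ge_iff_le,
    ← smul_sub, sub_sub_sub_cancel_right, mulVec_smul, smul_dotProduct, dotProduct_smul,
    smul_eq_mul]
  rw [← mul_assoc, Real.mul_self_sqrt hm.le, le_div_iff₀ two_pos, div_mul_eq_mul_div,
    div_le_iff₀ hm]
  constructor <;> intro h <;> linarith
end
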